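/- arXiv:1304.8074 — 2 statements merged into one kernel-verified Lean document; each statement's English description precedes it below -/
import Mathlib

section
/- Free face lemma: Let A ∈ S m and b ∈ S (m-1) be cells such that b is a free face of A, i.e. the coefficient (∂A) b equals 1 and (∂x) b = 0 for every cell x ∈ S m with x ≠ A. Then for every cell y ∈ S (m+1) the coefficient (∂y) A equals 0. -/
/-- Cast along an equality of degrees. -/
noncomputable def mcast (M : ℤ → Type) [∀ n, AddCommGroup (M n)] [∀ n, Module (ZMod 2) (M n)]
    {n m : ℤ} (h : n = m) : M n ≃ₗ[ZMod 2] M m := by cases h; exact LinearEquiv.refl _ _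

theorem free_face_aux
    (S : ℤ → Type)
    (d : ∀ n : ℤ, (S n →₀ ZMod 2) →ₗ[ZMod 2] (S (n-1) →₀ ZMod 2))
    (m : ℤ) (A : S m) (b : S (m-1))
    (hAb : (d m (Finsupp.single A 1)) b = 1)
    (hfree : ∀ x : S m, x ≠ A → (d m (Finsupp.single x 1)) b = 0)
    (k : ℤ) (h : k = m) (w : S k →₀ ZMod 2) (hw : d k w = 0) :
    (mcast (fun k => S k →₀ ZMod 2) h w) A = 0 := by
  subst h
  have key : (Finsupp.lapply b).comp (d k) = (Finsupp.lapply A : _ →ₗ[ZMod 2] ZMod 2) := by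
    apply Finsupp.lhom_ext'
    intro x
    apply LinearMap.ext_ring
    by_cases hx : x = A
    · subst hx
      simpa using hAb
    · simpa [Finsupp.single_apply, hx] using hfree x hx
  have h2 := LinearMap.congr_fun key w
  simp [hw] at h2
  exact h2.symm

/-- Free face lemma: if `b` is a free face of `A` then `A` does not appear in the boundary of
any cell of dimension one higher. -/
theorem free_face_lemma
    (S : ℤ → Type)
    (d : ∀ n : ℤ, (S n →₀ ZMod 2) →ₗ[ZMod 2] (S (n-1) →₀ ZMod 2))
    (hd : ∀ n : ℤ, (d (n-1)).comp (d n) = 0)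
    (m : ℤ) (A : S m) (b : S (m-1))
    (hAb : (d m (Finsupp.single A 1)) b = 1)
    (hfree : ∀ x : S m, x ≠ A → (d m (Finsupp.single x 1)) b = 0) :
    ∀ y : S (m+1),
      (mcast (fun k => S k →₀ ZMod 2) (show m+1-1 = m by ring)
        (d (m+1) (Finsupp.single y 1))) A = 0 := by
  intro y
  exact free_face_aux S d m A b hAb hfree (m+1-1) (by ring) _
    (LinearMap.congr_fun (hd (m+1)) (Finsupp.single y 1))
end

section
/- The coreduction-reduced boundary is a differential: Let A ∈ S m and b ∈ S (m-1) be cells forming a coreduction pair, i.e. ∂A = Finsupp.single b 1 (b is the unique cell in the boundary of A). Then the deleted boundary maps d' of the reduced complex K∖{A,b} satisfy d' (n-1) ∘ d' n = 0 for every n, so K∖{A,b} is again a cellular chain complex. -/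
noncomputable section

variable (S : ℤ → Type) (d : ∀ n : ℤ, (S n →₀ ZMod 2) →ₗ[ZMod 2] (S (n-1) →₀ ZMod 2))

/-- Chains of the restricted complex: finitely supported functions on the cells satisfying `P`. -/
abbrev rCh (P : ∀ n : ℤ, S n → Prop) (n : ℤ) : Type := {x : S n // P n x} →₀ ZMod 2

/-- The boundary of the restricted complex: extend by zero, take the boundary, delete the
coefficients at the cells not satisfying `P`. -/
def resD (P : ∀ n : ℤ, S n → Prop) (n : ℤ) : rCh S P n →ₗ[ZMod 2] rCh S P (n-1) :=
  (Finsupp.lsubtypeDomain (R := ZMod 2) {x : S (n-1) | P (n-1) x}).comp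
    ((d n).comp (Finsupp.lmapDomain (ZMod 2) (ZMod 2) Subtype.val))

/-- The cells different from the two given cells `A ∈ S m` and `b ∈ S (m-1)`. -/
def offPair (m : ℤ) (A : S m) (b : S (m-1)) : ∀ n : ℤ, S n → Prop :=
  fun n x => (⟨n, x⟩ : Σ k, S k) ≠ ⟨m, A⟩ ∧ (⟨n, x⟩ : Σ k, S k) ≠ ⟨m - 1, b⟩

end

theorem aux_bad (S : ℤ → Type)
    (d : ∀ n : ℤ, (S n →₀ ZMod 2) →ₗ[ZMod 2] (S (n-1) →₀ ZMod 2))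
    (hd : ∀ n : ℤ, (d (n-1)).comp (d n) = 0)
    (m : ℤ) (A : S m) (b : S (m-1))
    (hAb : d m (Finsupp.single A 1) = Finsupp.single b 1)
    (k : ℤ) (y : S k) (hy : ¬ offPair S m A b k y) (c : S (k-1))
    (hc : offPair S m A b (k-1) c) : d k (Finsupp.single y 1) c = 0 := by
  have h : (⟨k, y⟩ : Σ k, S k) = ⟨m, A⟩ ∨ (⟨k, y⟩ : Σ k, S k) = ⟨m - 1, b⟩ := by
    unfold offPair at hy
    tauto
  rcases h with h | h
  · cases h
    rw [hAb]
    apply Finsupp.single_eq_of_ne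
    rintro rfl
    exact hc.2 rfl
  · cases h
    rw [← hAb]
    have := LinearMap.congr_fun (hd m) (Finsupp.single A 1)
    rw [LinearMap.comp_apply] at this
    rw [this]
    rfl

theorem aux_ext (S : ℤ → Type)
    (d : ∀ n : ℤ, (S n →₀ ZMod 2) →ₗ[ZMod 2] (S (n-1) →₀ ZMod 2))
    (P : ∀ n : ℤ, S n → Prop) (k : ℤ) (c : S (k-1))
    (h : ∀ y : S k, ¬ P k y → d k (Finsupp.single y 1) c = 0) (z : S k →₀ ZMod 2) :
    d k (Finsupp.mapDomain Subtype.val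
      (Finsupp.lsubtypeDomain (R := ZMod 2) {x : S k | P k x} z)) c = d k z c := by
  have key : (Finsupp.lapply c).comp ((d k).comp ((Finsupp.lmapDomain (ZMod 2) (ZMod 2)
      Subtype.val).comp (Finsupp.lsubtypeDomain (R := ZMod 2) {x : S k | P k x})))
      = (Finsupp.lapply (R := ZMod 2) c).comp (d k) := by
    apply Finsupp.lhom_ext'
    intro y
    apply LinearMap.ext_ring
    simp only [LinearMap.comp_apply, Finsupp.lsingle_apply, Finsupp.lapply_apply,
      Finsupp.lmapDomain_apply]
    by_cases hy : P k y
    · have : Finsupp.lsubtypeDomain (R := ZMod 2) {x : S k | P k x} (Finsupp.single y (1 : ZMod 2))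
          = Finsupp.single ⟨y, hy⟩ 1 := by
        classical
        ext x
        simp [Finsupp.lsubtypeDomain, Finsupp.single_apply, Subtype.ext_iff]
      rw [this, Finsupp.mapDomain_single]
    · have : Finsupp.lsubtypeDomain (R := ZMod 2) {x : S k | P k x} (Finsupp.single y (1 : ZMod 2))
          = 0 := by
        ext x
        have hx : x.1 ≠ y := by
          rintro rfl
          exact hy x.2
        exact Finsupp.single_eq_of_ne hx
      rw [this, h y hy]
      simp
  exact LinearMap.congr_fun key z

/-- If `(A, b)` is a coreduction pair, then the deleted boundary of the reduced complex
`K∖{A,b}` squares to zero, i.e. `K∖{A,b}` is again a cellular chain complex. -/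
theorem coreduction_reduced_boundary_squares_to_zero
    (S : ℤ → Type)
    (d : ∀ n : ℤ, (S n →₀ ZMod 2) →ₗ[ZMod 2] (S (n-1) →₀ ZMod 2))
    (hd : ∀ n : ℤ, (d (n-1)).comp (d n) = 0)
    (m : ℤ) (A : S m) (b : S (m-1))
    (hAb : d m (Finsupp.single A 1) = Finsupp.single b 1) :
    ∀ n : ℤ, (resD S d (offPair S m A b) (n-1)).comp (resD S d (offPair S m A b) n) = 0 := by
  intro n
  apply LinearMap.ext
  intro x
  apply Finsupp.ext
  intro c
  have h1 := aux_ext S d (offPair S m A b) (n-1) c.1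
    (fun y hy => aux_bad S d hd m A b hAb (n-1) y hy c.1 c.2)
    (d n (Finsupp.mapDomain Subtype.val x))
  have h2 := LinearMap.congr_fun (hd n) (Finsupp.mapDomain Subtype.val x)
  rw [LinearMap.comp_apply] at h2
  rw [h2] at h1
  exact h1
end
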